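/- Let f : [a,b] → X have the property S*HK on [a,b], let Z₁ = { t₁ ∈ [a₁,b₁] : the section f_{t₁} does not have the property S*HK on [a₂,b₂] }, Z₂ = { t₂ ∈ [a₂,b₂] : the section f_{t₂} does not have the property S*HK on [a₁,b₁] }, and Z = (Z₁ × [a₂,b₂]) ∪ ([a₁,b₁] × Z₂). Then the indicator function 𝟙_Z is Henstock–Kurzweil integrable on [a,b] with (HK)∫_{[a,b]} 𝟙_Z = 0. -/

import Mathlib

open Set MeasureTheory

variable {E : Type*} [MeasureSpace E] [PseudoMetricSpace E] [Preorder E]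
variable {X : Type*} [NormedAddCommGroup X] [NormedSpace ℝ X]

/-- The closed interval of a tagged item `(t, p, q)` is `[p, q]` (the tag is `t`). -/
def itemBox (x : E × E × E) : Set E := Set.Icc x.2.1 x.2.2

/-- `[p,q]` is a closed non-degenerate subinterval of `K`. -/
def IsSubinterval (K : Set E) (p q : E) : Prop :=
  Set.Icc p q ⊆ K ∧ (interior (Set.Icc p q)).Nonempty

/-- `P` is an `𝓜`-partition of `K`: a finite collection of tagged pairwise
non-overlapping closed non-degenerate subintervals of `K` covering `K`, with tags in `K`. -/
def IsMPartition (K : Set E) (P : Finset (E × E × E)) : Prop :=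
  (∀ x ∈ P, x.1 ∈ K ∧ IsSubinterval K x.2.1 x.2.2) ∧
  (∀ x ∈ P, ∀ y ∈ P, x ≠ y → interior (itemBox x) ∩ interior (itemBox y) = ∅) ∧
  (⋃ x ∈ P, itemBox x) = K

/-- `𝓗𝓚`-partition: an `𝓜`-partition each of whose tags belongs to its interval. -/
def IsHKPartition (K : Set E) (P : Finset (E × E × E)) : Prop :=
  IsMPartition K P ∧ ∀ x ∈ P, x.1 ∈ itemBox x

/-- A gauge on `K`: positive on `K`. -/
def IsGauge (K : Set E) (δ : E → ℝ) : Prop := ∀ t ∈ K, 0 < δ t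

/-- A tagged partition is `δ`-fine if each interval lies in the open ball
around its tag of radius `δ(tag)`. -/
def IsFine (δ : E → ℝ) (P : Finset (E × E × E)) : Prop :=
  ∀ x ∈ P, itemBox x ⊆ Metric.ball x.1 (δ x.1)

/-- `f` is McShane integrable on `K` with integral `v`. -/
def HasMcShaneIntegral (K : Set E) (f : E → X) (v : X) : Prop :=
  ∀ ε > 0, ∃ δ : E → ℝ, IsGauge K δ ∧
    ∀ P : Finset (E × E × E), IsMPartition K P → IsFine δ P →
      ‖(∑ x ∈ P, (volume (itemBox x)).toReal • f x.1) - v‖ < ε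

/-- `f` is Henstock–Kurzweil integrable on `K` with integral `v`. -/
def HasHKIntegral (K : Set E) (f : E → X) (v : X) : Prop :=
  ∀ ε > 0, ∃ δ : E → ℝ, IsGauge K δ ∧
    ∀ P : Finset (E × E × E), IsHKPartition K P → IsFine δ P →
      ‖(∑ x ∈ P, (volume (itemBox x)).toReal • f x.1) - v‖ < ε

/-- An additive interval function on the non-degenerate closed subintervals of `K`
(an interval is recorded by its pair of corners). -/
def IsAdditiveIntervalFun (K : Set E) (F : E × E → X) : Prop :=
  ∀ p q r s u w : E, IsSubinterval K p q → IsSubinterval K r s → IsSubinterval K u w →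
    interior (Set.Icc p q) ∩ interior (Set.Icc r s) = ∅ →
    Set.Icc p q ∪ Set.Icc r s = Set.Icc u w →
    F (u, w) = F (p, q) + F (r, s)

/-- `f` is strongly McShane integrable on `[a,b]` with `(M)∫_{[a,b]} f = v`. -/
def HasStrongMcShaneIntegral (a b : E) (f : E → X) (v : X) : Prop :=
  ∃ F : E × E → X, IsAdditiveIntervalFun (Set.Icc a b) F ∧ F (a, b) = v ∧
    ∀ ε > 0, ∃ δ : E → ℝ, IsGauge (Set.Icc a b) δ ∧
      ∀ P : Finset (E × E × E), IsMPartition (Set.Icc a b) P → IsFine δ P →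
        ∑ x ∈ P, ‖(volume (itemBox x)).toReal • f x.1 - F (x.2.1, x.2.2)‖ < ε

/-- `f` is strongly Henstock–Kurzweil integrable on `[a,b]` with `(HK)∫_{[a,b]} f = v`. -/
def HasStrongHKIntegral (a b : E) (f : E → X) (v : X) : Prop :=
  ∃ F : E × E → X, IsAdditiveIntervalFun (Set.Icc a b) F ∧ F (a, b) = v ∧
    ∀ ε > 0, ∃ δ : E → ℝ, IsGauge (Set.Icc a b) δ ∧
      ∀ P : Finset (E × E × E), IsHKPartition (Set.Icc a b) P → IsFine δ P →
        ∑ x ∈ P, ‖(volume (itemBox x)).toReal • f x.1 - F (x.2.1, x.2.2)‖ < ε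

/-- Property `𝓢*𝓜` on `[a,b]`. -/
def PropSM (a b : E) (f : E → X) : Prop :=
  ∀ ε > 0, ∃ δ : E → ℝ, IsGauge (Set.Icc a b) δ ∧
    ∀ P Q : Finset (E × E × E),
      IsMPartition (Set.Icc a b) P → IsFine δ P →
      IsMPartition (Set.Icc a b) Q → IsFine δ Q →
      ∑ x ∈ P, ∑ y ∈ Q, ‖f x.1 - f y.1‖ * (volume (itemBox x ∩ itemBox y)).toReal < ε

/-- Property `𝓢*𝓗𝓚` on `[a,b]`. -/
def PropSHK (a b : E) (f : E → X) : Prop :=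
  ∀ ε > 0, ∃ δ : E → ℝ, IsGauge (Set.Icc a b) δ ∧
    ∀ P Q : Finset (E × E × E),
      IsHKPartition (Set.Icc a b) P → IsFine δ P →
      IsHKPartition (Set.Icc a b) Q → IsFine δ Q →
      ∑ x ∈ P, ∑ y ∈ Q, ‖f x.1 - f y.1‖ * (volume (itemBox x ∩ itemBox y)).toReal < ε

/-- If a relation on endpoints of intervals can be glued along common endpoints and holds for all
small intervals around each point, then it holds for `[a, b]`. -/
theorem cousin_induction {a b : ℝ} (hab : a < b) {S : ℝ → ℝ → Prop}
    (glue : ∀ u v w, u < v → v < w → S u v → S v w → S u w)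
    (loc : ∀ t ∈ Icc a b, ∃ r > 0, ∀ u v, u < v → u ∈ Icc a b → v ∈ Icc a b →
      t ∈ Icc u v → v < t + r → t - r < u → S u v) : S a b := by
  set s : Set ℝ := {x | x ∈ Icc a b ∧ (x = a ∨ S a x)}
  have ha : a ∈ s := ⟨⟨le_rfl, hab.le⟩, Or.inl rfl⟩
  have hbdd : BddAbove s := ⟨b, fun x hx => hx.1.2⟩
  have hac : a ≤ sSup s := le_csSup hbdd ha
  have hcb : sSup s ≤ b := csSup_le ⟨a, ha⟩ fun x hx => hx.1.2
  set c := sSup s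
  obtain ⟨r, hr, hloc⟩ := loc c ⟨hac, hcb⟩
  obtain ⟨y, hy, hyc⟩ := exists_lt_of_lt_csSup ⟨a, ha⟩ (sub_lt_self c hr)
  have hyc' : y ≤ c := le_csSup hbdd hy
  have step : ∀ z ∈ Icc a b, c ≤ z → y < z → z < c + r → S a z := by
    intro z hz hcz hyz hzr
    have hyz' : S y z := hloc y z hyz hy.1 hz ⟨hyc', hcz⟩ hzr hyc
    rcases hy.2 with h | h
    · exact h ▸ hyz'
    · rcases hy.1.1.eq_or_lt with h' | h'
      · exact h' ▸ hyz'
      · exact glue a y z h' hyz h hyz'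
  rcases hcb.eq_or_lt with h | h
  · rcases hyc'.eq_or_lt with h' | h'
    · have hyb : y = b := h'.trans h
      rcases hy.2 with h'' | h''
      · exact absurd (h''.symm.trans hyb) hab.ne
      · exact hyb ▸ h''
    · exact step b ⟨hab.le, le_rfl⟩ hcb (h ▸ h') (by linarith)
  · have hlt : c < min b (c + r / 2) := lt_min h (by linarith)
    have hz : min b (c + r / 2) ∈ Icc a b := ⟨hac.trans hlt.le, min_le_left _ _⟩
    have hmem : min b (c + r / 2) ∈ s :=
      ⟨hz, Or.inr (step _ hz hlt.le (hyc'.trans_lt hlt)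
        ((min_le_right _ _).trans_lt (by linarith)))⟩
    exact absurd (le_csSup hbdd hmem) (not_le.2 hlt)

theorem isSubinterval_real {K : Set ℝ} {p q : ℝ} :
    IsSubinterval K p q ↔ Icc p q ⊆ K ∧ p < q := by
  simp [IsSubinterval, interior_Icc]

theorem IsMPartition.itemBox_subset {E : Type*} [MeasureSpace E] [PseudoMetricSpace E] [Preorder E]
    {K : Set E} {P : Finset (E × E × E)} (hP : IsMPartition K P) {x : E × E × E} (hx : x ∈ P) :
    itemBox x ⊆ K :=
  (hP.1 x hx).2.1

theorem isHKPartition_singleton {t u v : ℝ} (huv : u < v) (ht : t ∈ Icc u v) :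
    IsHKPartition (Icc u v) {(t, u, v)} := by
  refine ⟨⟨?_, ?_, ?_⟩, ?_⟩
  · simpa [isSubinterval_real, huv] using ht
  · intro x hx y hy hxy
    simp only [Finset.mem_singleton] at hx hy
    exact absurd (hx.trans hy.symm) hxy
  · simp [itemBox]
  · simpa [itemBox] using ht

theorem IsHKPartition.union_adjacent {u v w : ℝ} (huv : u < v) (hvw : v < w)
    {P Q : Finset (ℝ × ℝ × ℝ)} (hP : IsHKPartition (Icc u v) P) (hQ : IsHKPartition (Icc v w) Q) :
    IsHKPartition (Icc u w) (P ∪ Q) := by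
  have huK : Icc u v ⊆ Icc u w := Icc_subset_Icc le_rfl hvw.le
  have hvK : Icc v w ⊆ Icc u w := Icc_subset_Icc huv.le le_rfl
  have hdisj : ∀ x ∈ P, ∀ y ∈ Q, interior (itemBox x) ∩ interior (itemBox y) = ∅ := by
    intro x hx y hy
    have h1 := interior_mono (hP.1.itemBox_subset hx)
    have h2 := interior_mono (hQ.1.itemBox_subset hy)
    rw [interior_Icc] at h1 h2
    exact eq_empty_of_forall_notMem fun z hz =>
      lt_asymm (h1 hz.1).2 (h2 hz.2).1
  refine ⟨⟨?_, ?_, ?_⟩, ?_⟩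
  · intro x hx
    rcases Finset.mem_union.1 hx with hx | hx
    · exact ⟨huK (hP.1.1 x hx).1, (hP.1.1 x hx).2.1.trans huK, (hP.1.1 x hx).2.2⟩
    · exact ⟨hvK (hQ.1.1 x hx).1, (hQ.1.1 x hx).2.1.trans hvK, (hQ.1.1 x hx).2.2⟩
  · intro x hx y hy hxy
    rcases Finset.mem_union.1 hx with hx | hx <;> rcases Finset.mem_union.1 hy with hy | hy
    · exact hP.1.2.1 x hx y hy hxy
    · exact hdisj x hx y hy
    · rw [inter_comm]; exact hdisj y hy x hx
    · exact hQ.1.2.1 x hx y hy hxy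
  · rw [Finset.set_biUnion_union, hP.1.2.2, hQ.1.2.2, Icc_union_Icc_eq_Icc huv.le hvw.le]
  · intro x hx
    rcases Finset.mem_union.1 hx with hx | hx
    · exact hP.2 x hx
    · exact hQ.2 x hx

/-- Cousin's lemma, with control of the tags: if the gauge is bounded below on `A`, there is a fine
partition in which the intervals tagged in `A` cover `A`. -/
theorem exists_fine_isHKPartition_cover {a b : ℝ} (hab : a < b) {δ : ℝ → ℝ}
    (hδ : IsGauge (Icc a b) δ) {A : Set ℝ} (hA : A ⊆ Icc a b) {c : ℝ} (hc : 0 < c)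
    (hAc : ∀ z ∈ A, c ≤ δ z) :
    ∃ P : Finset (ℝ × ℝ × ℝ), IsHKPartition (Icc a b) P ∧ IsFine δ P ∧
      ∀ z ∈ A, ∃ x ∈ P, x.1 ∈ A ∧ z ∈ itemBox x := by
  suffices h : ∃ P : Finset (ℝ × ℝ × ℝ), IsHKPartition (Icc a b) P ∧ IsFine δ P ∧
      ∀ z ∈ A ∩ Icc a b, ∃ x ∈ P, x.1 ∈ A ∧ z ∈ itemBox x by
    obtain ⟨P, h1, h2, h3⟩ := h
    exact ⟨P, h1, h2, fun z hz => h3 z ⟨hz, hA hz⟩⟩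
  refine cousin_induction hab (S := fun u v => ∃ P : Finset (ℝ × ℝ × ℝ),
    IsHKPartition (Icc u v) P ∧ IsFine δ P ∧
      ∀ z ∈ A ∩ Icc u v, ∃ x ∈ P, x.1 ∈ A ∧ z ∈ itemBox x) ?_ ?_
  · rintro u v w huv hvw ⟨P, hP, hPδ, hPA⟩ ⟨Q, hQ, hQδ, hQA⟩
    refine ⟨P ∪ Q, hP.union_adjacent huv hvw hQ, ?_, ?_⟩
    · intro x hx
      rcases Finset.mem_union.1 hx with hx | hx
      · exact hPδ x hx
      · exact hQδ x hx
    · rintro z ⟨hzA, hz⟩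
      rcases le_total z v with h | h
      · obtain ⟨x, hx, hx'⟩ := hPA z ⟨hzA, hz.1, h⟩
        exact ⟨x, Finset.mem_union_left _ hx, hx'⟩
      · obtain ⟨x, hx, hx'⟩ := hQA z ⟨hzA, h, hz.2⟩
        exact ⟨x, Finset.mem_union_right _ hx, hx'⟩
  · intro t ht
    refine ⟨min (δ t) (c / 2), lt_min (hδ t ht) (by linarith), ?_⟩
    intro u v huv _ _ htuv hv hu
    have h1 := min_le_left (δ t) (c / 2)
    have h2 := min_le_right (δ t) (c / 2)
    by_cases hne : (A ∩ Icc u v).Nonempty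
    · obtain ⟨z, hzA, hz⟩ := hne
      refine ⟨{(z, u, v)}, isHKPartition_singleton huv hz, ?_, ?_⟩
      · intro x hx
        rw [Finset.mem_singleton.1 hx]
        intro y hy
        have hcz := hAc z hzA
        have hy' : y ∈ Icc u v := hy
        have hy1 := hy'.1
        have hy2 := hy'.2
        have hz1 := hz.1
        have hz2 := hz.2
        rw [Metric.mem_ball, Real.dist_eq, abs_lt]
        constructor <;> simp only <;> linarith
      · rintro y ⟨_, hy⟩
        exact ⟨_, Finset.mem_singleton_self _, hzA, hy⟩
    · refine ⟨{(t, u, v)}, isHKPartition_singleton huv htuv, ?_, ?_⟩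
      · intro x hx
        rw [Finset.mem_singleton.1 hx]
        intro y hy
        have hy' : y ∈ Icc u v := hy
        have hy1 := hy'.1
        have hy2 := hy'.2
        rw [Metric.mem_ball, Real.dist_eq, abs_lt]
        constructor <;> simp only <;> linarith
      · intro z hz
        exact absurd ⟨z, hz⟩ hne

open Classical in
/-- A set whose indicator has Henstock–Kurzweil integral zero is Lebesgue null. -/
theorem volume_eq_zero_of_gauge {a b : ℝ} (hab : a < b) {Z : Set ℝ} (hZ : Z ⊆ Icc a b)
    (h : ∀ η > 0, ∃ δ : ℝ → ℝ, IsGauge (Icc a b) δ ∧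
      ∀ P : Finset (ℝ × ℝ × ℝ), IsHKPartition (Icc a b) P → IsFine δ P →
        ∑ x ∈ P with x.1 ∈ Z, (volume (itemBox x)).toReal ≤ η) :
    volume Z = 0 := by
  refine le_antisymm (ENNReal.le_of_forall_pos_le_add fun η hη _ => ?_) zero_le
  obtain ⟨δ, hδ, hP⟩ := h η hη
  have hmono : Monotone fun k : ℕ => Z ∩ {t | 1 / ((k : ℝ) + 1) ≤ δ t} := by
    intro k l hkl t ht
    exact ⟨ht.1, le_trans (b := 1 / ((k : ℝ) + 1)) (Nat.one_div_le_one_div hkl) ht.2⟩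
  have hcover : Z ⊆ ⋃ k : ℕ, Z ∩ {t | 1 / ((k : ℝ) + 1) ≤ δ t} := by
    intro t ht
    obtain ⟨k, hk⟩ := exists_nat_one_div_lt (hδ t (hZ ht))
    exact mem_iUnion.2 ⟨k, ht, hk.le⟩
  refine (measure_mono hcover).trans ?_
  rw [hmono.measure_iUnion, zero_add]
  refine iSup_le fun k => ?_
  obtain ⟨P, hPK, hPδ, hPA⟩ := exists_fine_isHKPartition_cover hab hδ
    (A := Z ∩ {t | 1 / ((k : ℝ) + 1) ≤ δ t}) (inter_subset_left.trans hZ)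
    (c := 1 / ((k : ℝ) + 1)) (by positivity) (fun z hz => hz.2)
  have hsub : Z ∩ {t | 1 / ((k : ℝ) + 1) ≤ δ t} ⊆ ⋃ x ∈ P.filter (fun x => x.1 ∈ Z), itemBox x := by
    intro z hz
    obtain ⟨x, hx, hxA, hzx⟩ := hPA z hz
    exact mem_biUnion (Finset.mem_coe.2 (Finset.mem_filter.2 ⟨hx, hxA.1⟩)) hzx
  calc volume (Z ∩ {t | 1 / ((k : ℝ) + 1) ≤ δ t})
      ≤ ∑ x ∈ P with x.1 ∈ Z, volume (itemBox x) :=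
        (measure_mono hsub).trans (measure_biUnion_finset_le _ _)
    _ = ∑ x ∈ P with x.1 ∈ Z, ENNReal.ofReal (volume (itemBox x)).toReal :=
        Finset.sum_congr rfl fun x _ =>
          (ENNReal.ofReal_toReal isCompact_Icc.measure_lt_top.ne).symm
    _ = ENNReal.ofReal (∑ x ∈ P with x.1 ∈ Z, (volume (itemBox x)).toReal) :=
        (ENNReal.ofReal_sum_of_nonneg fun _ _ => ENNReal.toReal_nonneg).symm
    _ ≤ η := by
        rw [← ENNReal.ofReal_coe_nnreal]
        exact ENNReal.ofReal_le_ofReal (hP P hPK hPδ)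

open Classical in
/-- The indicator of a Lebesgue null set in the plane has Henstock–Kurzweil integral zero. -/
theorem hasHKIntegral_indicator_of_volume_eq_zero (K : Set (ℝ × ℝ)) {Z : Set (ℝ × ℝ)}
    (hZ : volume Z = 0) : HasHKIntegral K (Z.indicator fun _ => (1 : ℝ)) 0 := by
  intro ε hε
  obtain ⟨U, hZU, hU, hUε⟩ := Z.exists_isOpen_lt_of_lt (μ := volume) (ENNReal.ofReal ε)
    (by rw [hZ]; exact ENNReal.ofReal_pos.2 hε)
  have hball : ∀ t : ℝ × ℝ, ∃ r > 0, t ∈ Z → Metric.ball t r ⊆ U := by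
    intro t
    by_cases ht : t ∈ Z
    · obtain ⟨r, hr, hr'⟩ := Metric.isOpen_iff.1 hU t (hZU ht)
      exact ⟨r, hr, fun _ => hr'⟩
    · exact ⟨1, one_pos, fun h => absurd h ht⟩
  choose δ hδ hδU using hball
  refine ⟨δ, fun t _ => hδ t, fun P hP hPδ => ?_⟩
  have hsum : ∑ x ∈ P, (volume (itemBox x)).toReal • Z.indicator (fun _ => (1 : ℝ)) x.1 =
      ∑ x ∈ P with x.1 ∈ Z, (volume (itemBox x)).toReal := by
    rw [Finset.sum_filter]
    refine Finset.sum_congr rfl fun x _ => ?_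
    by_cases hx : x.1 ∈ Z <;> simp [hx]
  have hint : ∀ x : (ℝ × ℝ) × (ℝ × ℝ) × (ℝ × ℝ),
      volume (interior (itemBox x)) = volume (itemBox x) := fun x =>
    measure_congr (interior_ae_eq_of_null_frontier ((convex_Icc _ _).addHaar_frontier volume))
  have hle : ∑ x ∈ P with x.1 ∈ Z, volume (itemBox x) ≤ volume U := by
    calc ∑ x ∈ P with x.1 ∈ Z, volume (itemBox x)
        = ∑ x ∈ P with x.1 ∈ Z, volume (interior (itemBox x)) :=
          Finset.sum_congr rfl fun x _ => (hint x).symm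
      _ = volume (⋃ x ∈ P.filter (fun x => x.1 ∈ Z), interior (itemBox x)) := by
          refine (measure_biUnion_finset ?_ fun x _ => isOpen_interior.measurableSet).symm
          intro x hx y hy hxy
          exact disjoint_iff_inter_eq_empty.2 (hP.1.2.1 x (Finset.mem_filter.1 hx).1 y
            (Finset.mem_filter.1 hy).1 hxy)
      _ ≤ volume U := by
          refine measure_mono (iUnion₂_subset fun x hx => interior_subset.trans ?_)
          obtain ⟨hxP, hxZ⟩ := Finset.mem_filter.1 hx
          exact (hPδ x hxP).trans (hδU x.1 hxZ)
  have hfin : ∀ x ∈ P.filter (fun x => x.1 ∈ Z), volume (itemBox x) ≠ ⊤ := fun x _ =>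
    isCompact_Icc.measure_lt_top.ne
  rw [hsum, sub_zero, Real.norm_of_nonneg (Finset.sum_nonneg fun _ _ => ENNReal.toReal_nonneg),
    ← ENNReal.toReal_sum hfin]
  exact (ENNReal.toReal_lt_of_lt_ofReal (hle.trans_lt hUε))

/-- Product of two tagged intervals. -/
def prodItem : (ℝ × ℝ × ℝ) × (ℝ × ℝ × ℝ) ↪ (ℝ × ℝ) × (ℝ × ℝ) × (ℝ × ℝ) where
  toFun z := ((z.1.1, z.2.1), (z.1.2.1, z.2.2.1), (z.1.2.2, z.2.2.2))
  inj' := by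
    rintro ⟨⟨a, b, c⟩, d, e, f⟩ ⟨⟨a', b', c'⟩, d', e', f'⟩ h
    simp only [Prod.mk.injEq] at h ⊢
    tauto

theorem prodItem_fst (x y : ℝ × ℝ × ℝ) : (prodItem (x, y)).1 = (x.1, y.1) :=
  rfl

theorem itemBox_prodItem (z : (ℝ × ℝ × ℝ) × (ℝ × ℝ × ℝ)) :
    itemBox (prodItem z) = itemBox z.1 ×ˢ itemBox z.2 :=
  (Icc_prod_Icc _ _ _ _).symm

open Classical in
/-- The tagged boxes `(t, s), I × J` with `(t, I) ∈ R` and `(s, J) ∈ N t`. -/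
noncomputable def fiberedProduct (R : Finset (ℝ × ℝ × ℝ)) (N : ℝ → Finset (ℝ × ℝ × ℝ)) :
    Finset ((ℝ × ℝ) × (ℝ × ℝ) × (ℝ × ℝ)) :=
  (R.biUnion fun x => (N x.1).map ⟨Prod.mk x, Prod.mk_right_injective x⟩).map prodItem

theorem mem_fiberedProduct {R : Finset (ℝ × ℝ × ℝ)} {N : ℝ → Finset (ℝ × ℝ × ℝ)}
    {w : (ℝ × ℝ) × (ℝ × ℝ) × (ℝ × ℝ)} :
    w ∈ fiberedProduct R N ↔ ∃ x ∈ R, ∃ y ∈ N x.1, prodItem (x, y) = w := by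
  simp only [fiberedProduct, Finset.mem_map, Finset.mem_biUnion, Function.Embedding.coeFn_mk]
  constructor
  · rintro ⟨_, ⟨x, hx, y, hy, rfl⟩, rfl⟩
    exact ⟨x, hx, y, hy, rfl⟩
  · rintro ⟨x, hx, y, hy, rfl⟩
    exact ⟨_, ⟨x, hx, y, hy, rfl⟩, rfl⟩

theorem sum_fiberedProduct (R : Finset (ℝ × ℝ × ℝ)) (N : ℝ → Finset (ℝ × ℝ × ℝ))
    (g : (ℝ × ℝ) × (ℝ × ℝ) × (ℝ × ℝ) → ℝ) :
    ∑ w ∈ fiberedProduct R N, g w = ∑ x ∈ R, ∑ y ∈ N x.1, g (prodItem (x, y)) := by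
  classical
  rw [fiberedProduct, Finset.sum_map, Finset.sum_biUnion]
  · simp
  · intro x _ x' _ hxx'
    rw [Function.onFun, Finset.disjoint_left]
    intro z hz hz'
    simp only [Finset.mem_map, Function.Embedding.coeFn_mk] at hz hz'
    obtain ⟨y, _, rfl⟩ := hz
    obtain ⟨y', _, h⟩ := hz'
    exact hxx' (Prod.mk.inj h).1.symm

theorem IsHKPartition.fiberedProduct {K L : Set ℝ} {R : Finset (ℝ × ℝ × ℝ)}
    {N : ℝ → Finset (ℝ × ℝ × ℝ)} (hR : IsHKPartition K R)
    (hN : ∀ t ∈ K, IsHKPartition L (N t)) :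
    IsHKPartition (K ×ˢ L) (fiberedProduct R N) := by
  have hN' : ∀ x ∈ R, IsHKPartition L (N x.1) := fun x hx => hN x.1 (hR.1.1 x hx).1
  refine ⟨⟨?_, ?_, ?_⟩, ?_⟩
  · intro w hw
    obtain ⟨x, hx, y, hy, rfl⟩ := mem_fiberedProduct.1 hw
    obtain ⟨hxt, hxs, hxi⟩ := hR.1.1 x hx
    obtain ⟨hyt, hys, hyi⟩ := (hN' x hx).1.1 y hy
    have hbox := itemBox_prodItem (x, y)
    refine ⟨⟨hxt, hyt⟩, ?_, ?_⟩
    · change itemBox (prodItem (x, y)) ⊆ _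
      rw [hbox]
      exact prod_mono hxs hys
    · change (interior (itemBox (prodItem (x, y)))).Nonempty
      rw [hbox, interior_prod_eq]
      exact hxi.prod hyi
  · intro w hw w' hw' hne
    obtain ⟨x, hx, y, hy, rfl⟩ := mem_fiberedProduct.1 hw
    obtain ⟨x', hx', y', hy', rfl⟩ := mem_fiberedProduct.1 hw'
    rw [itemBox_prodItem, itemBox_prodItem, interior_prod_eq, interior_prod_eq, prod_inter_prod]
    by_cases hxx' : x = x'
    · subst hxx'
      have hyy' : y ≠ y' := fun h => hne (by rw [h])
      rw [(hN' x hx).1.2.1 y hy y' hy' hyy', prod_empty]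
    · rw [hR.1.2.1 x hx x' hx' hxx', empty_prod]
  · ext ⟨t, s⟩
    constructor
    · intro h
      obtain ⟨w, hw, hts⟩ := mem_iUnion₂.1 h
      obtain ⟨x, hx, y, hy, rfl⟩ := mem_fiberedProduct.1 hw
      rw [itemBox_prodItem] at hts
      exact ⟨hR.1.itemBox_subset hx hts.1, (hN' x hx).1.itemBox_subset hy hts.2⟩
    · rintro ⟨ht, hs⟩
      obtain ⟨x, hx, hxt⟩ := mem_iUnion₂.1 (hR.1.2.2.symm ▸ ht)
      obtain ⟨y, hy, hys⟩ := mem_iUnion₂.1 ((hN' x hx).1.2.2.symm ▸ hs)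
      refine mem_iUnion₂.2 ⟨_, mem_fiberedProduct.2 ⟨x, hx, y, hy, rfl⟩, ?_⟩
      rw [itemBox_prodItem]
      exact ⟨hxt, hys⟩
  · intro w hw
    obtain ⟨x, hx, y, hy, rfl⟩ := mem_fiberedProduct.1 hw
    rw [itemBox_prodItem]
    exact ⟨hR.2 x hx, (hN' x hx).2 y hy⟩

theorem IsFine.fiberedProduct {δ : ℝ × ℝ → ℝ} {δ₁ : ℝ → ℝ} {R : Finset (ℝ × ℝ × ℝ)}
    {N : ℝ → Finset (ℝ × ℝ × ℝ)} (hR : IsFine δ₁ R)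
    (hN : ∀ x ∈ R, IsFine (fun s => δ (x.1, s)) (N x.1))
    (hδ₁ : ∀ x ∈ R, ∀ y ∈ N x.1, δ₁ x.1 ≤ δ (x.1, y.1)) :
    IsFine δ (fiberedProduct R N) := by
  intro w hw
  obtain ⟨x, hx, y, hy, rfl⟩ := mem_fiberedProduct.1 hw
  rw [itemBox_prodItem]
  change _ ⊆ Metric.ball (x.1, y.1) (δ (x.1, y.1))
  rw [← ball_prod_same]
  exact prod_mono ((hR x hx).trans (Metric.ball_subset_ball (hδ₁ x hx y hy))) (hN x hx y hy)

theorem volume_badSections_eq_zero {a₁ b₁ a₂ b₂ : ℝ} (hab₁ : a₁ < b₁) (hab₂ : a₂ < b₂)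
    {Y : Type*} [NormedAddCommGroup Y] {f : ℝ × ℝ → Y} (hf : PropSHK ((a₁, a₂) : ℝ × ℝ) (b₁, b₂) f) :
    volume {t : ℝ | t ∈ Icc a₁ b₁ ∧ ¬ PropSHK a₂ b₂ fun s => f (t, s)} = 0 := by
  classical
  set V : ℝ → Finset (ℝ × ℝ × ℝ) → Finset (ℝ × ℝ × ℝ) → ℝ := fun t P Q =>
    ∑ x ∈ P, ∑ y ∈ Q, ‖f (t, x.1) - f (t, y.1)‖ * (volume (itemBox x ∩ itemBox y)).toReal with hV
  set B : ℕ → Set ℝ := fun n => {t | t ∈ Icc a₁ b₁ ∧ ∀ δ : ℝ → ℝ, IsGauge (Icc a₂ b₂) δ →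
    ∃ P Q : Finset (ℝ × ℝ × ℝ), IsHKPartition (Icc a₂ b₂) P ∧ IsFine δ P ∧
      IsHKPartition (Icc a₂ b₂) Q ∧ IsFine δ Q ∧ 1 / ((n : ℝ) + 1) ≤ V t P Q}
  have hcover : {t : ℝ | t ∈ Icc a₁ b₁ ∧ ¬ PropSHK a₂ b₂ fun s => f (t, s)} ⊆ ⋃ n, B n := by
    rintro t ⟨ht, hbad⟩
    simp only [PropSHK] at hbad
    push Not at hbad
    obtain ⟨ε, hε, h⟩ := hbad
    obtain ⟨n, hn⟩ := exists_nat_one_div_lt hε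
    refine mem_iUnion.2 ⟨n, ht, fun δ hδ => ?_⟩
    obtain ⟨P, Q, hP, hPδ, hQ, hQδ, hle⟩ := h δ hδ
    exact ⟨P, Q, hP, hPδ, hQ, hQδ, hn.le.trans hle⟩
  refine measure_mono_null hcover (measure_iUnion_null fun n => ?_)
  refine volume_eq_zero_of_gauge hab₁ (fun t ht => ht.1) fun η hη => ?_
  obtain ⟨δ, hδ, hδf⟩ := hf (η * (1 / ((n : ℝ) + 1))) (by positivity)
  rw [← Icc_prod_Icc] at hδ hδf
  have hsec : ∀ t, ∃ P Q : Finset (ℝ × ℝ × ℝ), t ∈ Icc a₁ b₁ →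
      IsHKPartition (Icc a₂ b₂) P ∧ IsFine (fun s => δ (t, s)) P ∧
      IsHKPartition (Icc a₂ b₂) Q ∧ IsFine (fun s => δ (t, s)) Q ∧
      (t ∈ B n → 1 / ((n : ℝ) + 1) ≤ V t P Q) := by
    intro t
    by_cases ht : t ∈ Icc a₁ b₁
    · have hg : IsGauge (Icc a₂ b₂) fun s => δ (t, s) := fun s hs => hδ _ ⟨ht, hs⟩
      by_cases htB : t ∈ B n
      · obtain ⟨P, Q, hP, hPδ, hQ, hQδ, hle⟩ := htB.2 _ hg
        exact ⟨P, Q, fun _ => ⟨hP, hPδ, hQ, hQδ, fun _ => hle⟩⟩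
      · obtain ⟨P, hP, hPδ, _⟩ := exists_fine_isHKPartition_cover hab₂ hg
          (empty_subset _) one_pos (by simp)
        exact ⟨P, P, fun _ => ⟨hP, hPδ, hP, hPδ, fun h => absurd h htB⟩⟩
    · exact ⟨∅, ∅, fun h => absurd h ht⟩
  choose P Q hPQ using hsec
  have hmin : ∀ t, ∃ r > 0, t ∈ Icc a₁ b₁ → ∀ y ∈ P t ∪ Q t, r ≤ δ (t, y.1) := by
    intro t
    by_cases ht : t ∈ Icc a₁ b₁
    · have hpos : ∀ y ∈ P t ∪ Q t, 0 < δ (t, y.1) := by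
        intro y hy
        refine hδ _ ⟨ht, ?_⟩
        rcases Finset.mem_union.1 hy with hy | hy
        · exact ((hPQ t ht).1.1.1 y hy).1
        · exact ((hPQ t ht).2.2.1.1.1 y hy).1
      have hev : ∀ᶠ r in nhdsWithin (0 : ℝ) (Ioi 0), ∀ y ∈ P t ∪ Q t, r ≤ δ (t, y.1) :=
        (Filter.eventually_all_finset _).2 fun y hy =>
          nhdsWithin_le_nhds (Iic_mem_nhds (hpos y hy))
      obtain ⟨r, hr, hr0⟩ := (hev.and self_mem_nhdsWithin).exists
      exact ⟨r, hr0, fun _ => hr⟩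
    · exact ⟨1, one_pos, fun h => absurd h ht⟩
  choose δ₁ hδ₁ hδ₁le using hmin
  refine ⟨δ₁, fun t _ => hδ₁ t, fun R hR hRδ => ?_⟩
  have htag : ∀ x ∈ R, x.1 ∈ Icc a₁ b₁ := fun x hx => (hR.1.1 x hx).1
  have hlt := hδf (fiberedProduct R P) (fiberedProduct R Q)
    (hR.fiberedProduct fun t ht => (hPQ t ht).1)
    (hRδ.fiberedProduct (fun x hx => (hPQ _ (htag x hx)).2.1)
      fun x hx y hy => hδ₁le _ (htag x hx) y (Finset.mem_union_left _ hy))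
    (hR.fiberedProduct fun t ht => (hPQ t ht).2.2.1)
    (hRδ.fiberedProduct (fun x hx => (hPQ _ (htag x hx)).2.2.2.1)
      fun x hx y hy => hδ₁le _ (htag x hx) y (Finset.mem_union_right _ hy))
  rw [sum_fiberedProduct] at hlt
  have hterm : ∀ x ∈ R, (volume (itemBox x)).toReal * V x.1 (P x.1) (Q x.1) ≤
      ∑ y ∈ P x.1, ∑ w ∈ fiberedProduct R Q, ‖f (prodItem (x, y)).1 - f w.1‖ *
        (volume (itemBox (prodItem (x, y)) ∩ itemBox w)).toReal := by
    intro x hx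
    rw [hV, Finset.mul_sum]
    refine Finset.sum_le_sum fun y _ => ?_
    rw [sum_fiberedProduct, Finset.mul_sum]
    refine le_trans (le_of_eq ?_) (Finset.single_le_sum
      (fun x' _ => Finset.sum_nonneg fun _ _ => by positivity) hx)
    refine Finset.sum_congr rfl fun y' _ => ?_
    rw [itemBox_prodItem, itemBox_prodItem, prod_inter_prod, inter_self, Measure.volume_eq_prod,
      Measure.prod_prod, ENNReal.toReal_mul]
    rw [mul_left_comm, prodItem_fst, prodItem_fst]
  have hVnonneg : ∀ t P Q, 0 ≤ V t P Q := fun t P Q =>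
    Finset.sum_nonneg fun _ _ => Finset.sum_nonneg fun _ _ => by positivity
  have hsum : (∑ x ∈ R with x.1 ∈ B n, (volume (itemBox x)).toReal) * (1 / ((n : ℝ) + 1)) ≤
      η * (1 / ((n : ℝ) + 1)) := by
    refine le_trans ?_ hlt.le
    refine le_trans ?_ (Finset.sum_le_sum hterm)
    rw [Finset.sum_mul]
    refine le_trans (Finset.sum_le_sum fun x hx => ?_)
      (Finset.sum_le_sum_of_subset_of_nonneg (Finset.filter_subset _ _) fun x _ _ =>
        mul_nonneg ENNReal.toReal_nonneg (hVnonneg _ _ _))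
    obtain ⟨hxR, hxB⟩ := Finset.mem_filter.1 hx
    exact mul_le_mul_of_nonneg_left ((hPQ _ (htag x hxR)).2.2.2.2 hxB) ENNReal.toReal_nonneg
  have hle := le_of_mul_le_mul_right hsum (Nat.one_div_pos_of_nat (n := n))
  refine le_of_eq_of_le ?_ hle
  congr!

/-- Interchange of the two coordinates of a tagged interval. -/
def swapItem : (ℝ × ℝ) × (ℝ × ℝ) × (ℝ × ℝ) ↪ (ℝ × ℝ) × (ℝ × ℝ) × (ℝ × ℝ) where
  toFun x := (x.1.swap, x.2.1.swap, x.2.2.swap)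
  inj' := by
    rintro ⟨⟨a, b⟩, ⟨c, d⟩, e, f⟩ ⟨⟨a', b'⟩, ⟨c', d'⟩, e', f'⟩ h
    simp only [Prod.swap_prod_mk, Prod.mk.injEq] at h ⊢
    tauto

theorem preimage_swap_Icc (p q : ℝ × ℝ) :
    Prod.swap ⁻¹' Icc p q = Icc p.swap q.swap := by
  ext z
  simp only [mem_preimage, mem_Icc, Prod.le_def, Prod.fst_swap, Prod.snd_swap]
  tauto

theorem itemBox_swapItem (x : (ℝ × ℝ) × (ℝ × ℝ) × (ℝ × ℝ)) :
    itemBox (swapItem x) = Prod.swap ⁻¹' itemBox x :=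
  (preimage_swap_Icc _ _).symm

theorem interior_preimage_swap (s : Set (ℝ × ℝ)) :
    interior (Prod.swap ⁻¹' s) = Prod.swap ⁻¹' interior s :=
  ((Homeomorph.prodComm ℝ ℝ).preimage_interior s).symm

theorem IsHKPartition.map_swapItem {K : Set (ℝ × ℝ)} {P : Finset ((ℝ × ℝ) × (ℝ × ℝ) × (ℝ × ℝ))}
    (hP : IsHKPartition K P) : IsHKPartition (Prod.swap ⁻¹' K) (P.map swapItem) := by
  refine ⟨⟨?_, ?_, ?_⟩, ?_⟩
  · intro w hw
    obtain ⟨x, hx, rfl⟩ := Finset.mem_map.1 hw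
    obtain ⟨hxt, hxs, z, hz⟩ := hP.1.1 x hx
    have hbox := itemBox_swapItem x
    refine ⟨hxt, ?_, z.swap, ?_⟩
    · change itemBox (swapItem x) ⊆ _
      rw [hbox]
      exact preimage_mono hxs
    · change _ ∈ interior (itemBox (swapItem x))
      rw [hbox, interior_preimage_swap]
      exact hz
  · intro w hw w' hw' hne
    obtain ⟨x, hx, rfl⟩ := Finset.mem_map.1 hw
    obtain ⟨x', hx', rfl⟩ := Finset.mem_map.1 hw'
    rw [itemBox_swapItem, itemBox_swapItem, interior_preimage_swap, interior_preimage_swap,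
      ← preimage_inter, hP.1.2.1 x hx x' hx' fun h => hne (by rw [h]), preimage_empty]
  · rw [← hP.1.2.2, preimage_iUnion₂]
    ext z
    simp only [mem_iUnion, Finset.mem_map, exists_prop, exists_exists_and_eq_and, itemBox_swapItem]
  · intro w hw
    obtain ⟨x, hx, rfl⟩ := Finset.mem_map.1 hw
    rw [itemBox_swapItem]
    exact hP.2 x hx

theorem IsFine.map_swapItem {δ : ℝ × ℝ → ℝ} {P : Finset ((ℝ × ℝ) × (ℝ × ℝ) × (ℝ × ℝ))}
    (hP : IsFine (fun t => δ t.swap) P) : IsFine δ (P.map swapItem) := by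
  intro w hw
  obtain ⟨x, hx, rfl⟩ := Finset.mem_map.1 hw
  rw [itemBox_swapItem]
  intro z hz
  have h : dist z.swap x.1 < δ x.1.swap := hP x hx hz
  change dist z x.1.swap < δ x.1.swap
  rwa [Prod.dist_eq, max_comm]

theorem volume_preimage_swap (s : Set (ℝ × ℝ)) (hs : MeasurableSet s) :
    volume (Prod.swap ⁻¹' s) = volume s :=
  (Measure.measurePreserving_swap (μ := (volume : Measure ℝ))
    (ν := (volume : Measure ℝ))).measure_preimage hs.nullMeasurableSet

theorem PropSHK.comp_swap {Y : Type*} [NormedAddCommGroup Y] {a b : ℝ × ℝ} {f : ℝ × ℝ → Y}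
    (hf : PropSHK a b f) :
    PropSHK a.swap b.swap fun t => f t.swap := by
  intro ε hε
  obtain ⟨δ, hδ, h⟩ := hf ε hε
  have hK : Prod.swap ⁻¹' Icc a.swap b.swap = Icc a b := preimage_swap_Icc _ _
  refine ⟨fun t => δ t.swap, ?_, fun P Q hP hPδ hQ hQδ => ?_⟩
  · rw [← preimage_swap_Icc]
    exact fun t ht => hδ _ ht
  · have := h (P.map swapItem) (Q.map swapItem) (hK ▸ hP.map_swapItem) hPδ.map_swapItem
      (hK ▸ hQ.map_swapItem) hQδ.map_swapItem
    simp only [Finset.sum_map, itemBox_swapItem, ← preimage_inter] at this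
    refine lt_of_eq_of_lt ?_ this
    refine Finset.sum_congr rfl fun x _ => Finset.sum_congr rfl fun y _ => ?_
    rw [volume_preimage_swap (itemBox x ∩ itemBox y) (measurableSet_Icc.inter measurableSet_Icc)]
    rfl

/-- Lemma 2.3(iii): `Z = (Z₁ × [a₂,b₂]) ∪ ([a₁,b₁] × Z₂)` is null in `[a,b]`. -/
theorem indicator_badSections_hk_integral_zero {X : Type*} [NormedAddCommGroup X] [NormedSpace ℝ X] [CompleteSpace X] (a₁ b₁ a₂ b₂ : ℝ) (hab₁ : a₁ < b₁) (hab₂ : a₂ < b₂)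
    (f : ℝ × ℝ → X) (hf : PropSHK ((a₁, a₂) : ℝ × ℝ) (b₁, b₂) f)
    (Z₁ : Set ℝ) (hZ₁ : Z₁ = {t₁ : ℝ | t₁ ∈ Set.Icc a₁ b₁ ∧ ¬ PropSHK a₂ b₂ (fun s₂ => f (t₁, s₂))})
    (Z₂ : Set ℝ) (hZ₂ : Z₂ = {t₂ : ℝ | t₂ ∈ Set.Icc a₂ b₂ ∧ ¬ PropSHK a₁ b₁ (fun s₁ => f (s₁, t₂))})
    (Z : Set (ℝ × ℝ)) (hZ : Z = (Z₁ ×ˢ Set.Icc a₂ b₂) ∪ ((Set.Icc a₁ b₁) ×ˢ Z₂)) :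
    HasHKIntegral (Set.Icc ((a₁, a₂) : ℝ × ℝ) (b₁, b₂)) (Z.indicator (fun _ => (1 : ℝ))) 0 := by
  have h₁ : volume Z₁ = 0 := by
    rw [hZ₁]
    exact volume_badSections_eq_zero hab₁ hab₂ hf
  have h₂ : volume Z₂ = 0 := by
    rw [hZ₂]
    exact volume_badSections_eq_zero hab₂ hab₁ (f := fun t => f t.swap) hf.comp_swap
  apply hasHKIntegral_indicator_of_volume_eq_zero
  rw [hZ]
  refine measure_union_null ?_ ?_
  · rw [Measure.volume_eq_prod, Measure.prod_prod, h₁, zero_mul]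
  · rw [Measure.volume_eq_prod, Measure.prod_prod, h₂, mul_zero]
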